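/- Let E₀ ≥ 0 and suppose a measurable function E : [0,∞) → [0,∞) satisfies the distributional inequality −∫₀^∞ ∂ₜψ · E dt ≤ ψ(0) E₀ for all nonnegative ψ ∈ C_c^∞([0,∞)). Then E(t) ≤ E₀ for almost every t ≥ 0. -/

import Mathlib

open MeasureTheory

/-- A nonnegative smooth function `g` supported in `(0, R]` agrees on `(0, ∞)` with `-ψ'` for some
nonnegative test function `ψ` with `ψ 0 = ∫ g`. -/
lemma exists_contDiff_hasCompactSupport_deriv_eq_neg {g : ℝ → ℝ} {R : ℝ} (hR : 0 < R)
    (hg : ContDiff ℝ (⊤ : ℕ∞) g) (hg0 : ∀ t, 0 ≤ g t) (hsupp : Function.support g ⊆ Set.Ioc 0 R) :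
    ∃ ψ : ℝ → ℝ, ContDiff ℝ (⊤ : ℕ∞) ψ ∧ HasCompactSupport ψ ∧ (∀ t, 0 ≤ ψ t) ∧
      (∀ t, 0 < t → deriv ψ t = -g t) ∧ ψ 0 = ∫ t, g t := by
  let G : ℝ → ℝ := fun t => ∫ s in t..R, g s
  have hGd : ∀ t, HasDerivAt G (-g t) t := fun t =>
    intervalIntegral.integral_hasDerivAt_left (hg.continuous.intervalIntegrable _ _)
      hg.continuous.stronglyMeasurable.stronglyMeasurableAtFilter hg.continuous.continuousAt
  have hGderiv : deriv G = fun t => -g t := funext fun t => (hGd t).deriv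
  have hGsmooth : ContDiff ℝ (⊤ : ℕ∞) G := by
    rw [contDiff_infty_iff_deriv, hGderiv]
    exact ⟨fun t => (hGd t).differentiableAt, hg.neg⟩
  have hGzero : ∀ t, R ≤ t → G t = 0 := by
    intro t ht
    refine intervalIntegral.integral_zero_ae (Filter.Eventually.of_forall fun s hs => ?_)
    rw [Set.uIoc_of_ge ht] at hs
    exact Function.notMem_support.1 fun h => (hsupp h).2.not_gt hs.1
  have hGnonneg : ∀ t, 0 ≤ G t := by
    intro t
    rcases le_total R t with ht | ht
    · exact (hGzero t ht).ge
    · exact intervalIntegral.integral_nonneg ht fun s _ => hg0 s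
  let χ : ContDiffBump (0 : ℝ) := ⟨R + 1, R + 2, by linarith, by linarith⟩
  refine ⟨fun t => χ t * G t, χ.contDiff.mul hGsmooth, χ.hasCompactSupport.mul_right,
    fun t => mul_nonneg χ.nonneg (hGnonneg t), fun t ht => ?_, ?_⟩
  · rw [← (hGd t).deriv]
    apply Filter.EventuallyEq.deriv_eq
    rcases lt_or_ge R t with hRt | hRt
    · filter_upwards [lt_mem_nhds hRt] with s hs
      simp [hGzero s hs.le]
    · have hball : t ∈ Metric.ball (0 : ℝ) χ.rIn := by
        simp only [Metric.mem_ball, Real.dist_eq, sub_zero, abs_of_pos ht]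
        change t < R + 1
        linarith
      filter_upwards [χ.eventuallyEq_one_of_mem_ball hball] with s hs
      simp [hs]
  · have h1 : χ 0 = 1 :=
      χ.one_of_mem_closedBall (Metric.mem_closedBall_self χ.rIn_pos.le)
    simp only [h1, one_mul]
    exact intervalIntegral.integral_eq_integral_of_support_subset hsupp

/-- If a nonnegative locally integrable `E` satisfies the distributional inequality
`−∫₀^∞ ψ′ E ≤ ψ(0) E₀` for every nonnegative `ψ ∈ C_c^∞([0,∞))`, then `E ≤ E₀` a.e. on
`(0, ∞)`. -/
theorem stmt15 (E : ℝ → ℝ) (E₀ : ℝ) (hE₀ : 0 ≤ E₀)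
    (hEmeas : Measurable E)
    (hEloc : ∀ R : ℝ, IntegrableOn E (Set.Ioc 0 R))
    (hEpos : ∀ᵐ t ∂(volume.restrict (Set.Ioi (0:ℝ))), 0 ≤ E t)
    (hineq : ∀ ψ : ℝ → ℝ, ContDiff ℝ (⊤ : ℕ∞) ψ → HasCompactSupport ψ → (∀ t, 0 ≤ ψ t) →
      -∫ t in Set.Ioi (0:ℝ), deriv ψ t * E t ≤ ψ 0 * E₀) :
    ∀ᵐ t ∂(volume.restrict (Set.Ioi (0:ℝ))), E t ≤ E₀ := by
  have htest : ∀ (g : ℝ → ℝ) (R : ℝ), 0 < R → ContDiff ℝ (⊤ : ℕ∞) g → (∀ t, 0 ≤ g t) →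
      Function.support g ⊆ Set.Ioc 0 R →
      ∫ t in Set.Ioi (0:ℝ), g t * E t ≤ (∫ t, g t) * E₀ := by
    intro g R hR hg hg0 hsupp
    obtain ⟨ψ, hψ, hψc, hψ0, hψd, hψi⟩ :=
      exists_contDiff_hasCompactSupport_deriv_eq_neg hR hg hg0 hsupp
    have h := hineq ψ hψ hψc hψ0
    rwa [hψi, setIntegral_congr_fun (g := fun t => -(g t * E t)) measurableSet_Ioi
      (fun t ht => by simp only [hψd t ht, neg_mul]), integral_neg, neg_neg] at h
  let F : ℝ → ℝ := (Set.Ioi (0:ℝ)).indicator E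
  have hF : LocallyIntegrable F volume := by
    intro x
    refine ⟨Set.Iio (x + 1), Iio_mem_nhds (by linarith), ?_⟩
    rw [IntegrableOn, integrable_indicator_iff measurableSet_Ioi, IntegrableOn,
      Measure.restrict_restrict measurableSet_Ioi]
    exact (hEloc (x + 1)).mono_set fun t ht => ⟨ht.1, ht.2.le⟩
  let φ : ℕ → ContDiffBump (0 : ℝ) := fun n =>
    ⟨1 / ((n : ℝ) + 1), 2 * (1 / ((n : ℝ) + 1)), by positivity,
      by linarith [show (0 : ℝ) < 1 / ((n : ℝ) + 1) by positivity]⟩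
  have hφ : Filter.Tendsto (fun n => (φ n).rOut) Filter.atTop (nhds 0) := by
    simpa only [mul_zero] using (tendsto_one_div_add_atTop_nhds_zero_nat (𝕜 := ℝ)).const_mul 2
  have hlim := ContDiffBump.ae_convolution_tendsto_right_of_locallyIntegrable (μ := volume)
    (φ := φ) (K := 2) hφ (Filter.Eventually.of_forall fun n => le_rfl) hF
  rw [ae_restrict_iff' measurableSet_Ioi]
  filter_upwards [hlim] with x hx hx0
  have hFx : F x = E x := Set.indicator_of_mem hx0 E
  rw [← hFx]
  refine le_of_tendsto hx ?_
  filter_upwards [hφ.eventually_lt_const (show (0:ℝ) < x from hx0)] with n hn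
  have hbound := htest (fun t => (φ n).normed volume (x - t)) (x + (φ n).rOut)
    (add_pos hx0 (φ n).rOut_pos) ((φ n).contDiff_normed.comp (contDiff_const.sub contDiff_id))
    (fun t => (φ n).nonneg_normed _) (by
      intro t ht
      have h : x - t ∈ Function.support ((φ n).normed volume) := ht
      rw [(φ n).support_normed_eq, Metric.mem_ball, Real.dist_eq, sub_zero, abs_lt] at h
      exact ⟨by linarith [h.2], by linarith [h.1]⟩)
  rw [integral_sub_left_eq_self, (φ n).integral_normed, one_mul] at hbound
  rw [convolution_eq_swap]
  refine le_of_eq_of_le ?_ hbound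
  rw [← integral_indicator measurableSet_Ioi]
  refine integral_congr_ae (Filter.Eventually.of_forall fun t => ?_)
  simp only [ContinuousLinearMap.lsmul_apply, smul_eq_mul, F]
  by_cases ht : t ∈ Set.Ioi (0:ℝ) <;> simp [ht]
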